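/- Let 0 < ε < 1 and suppose ρ̂(G, M) < 1 − ε. Then for every integer T ≥ 1 with T ≥ −log(n) / log((1−ε)²), the lifted system S(G_T, M^T) admits a quadratic Lyapunov multinorm, i.e. a family of symmetric positive definite matrices (Q_v)_{v ∈ V} and a constant 0 < γ < 1 such that A_eᵀ Q_j A_e ⪯ γ² Q_i in the Loewner order for every edge e of G_T from v_i to v_j with associated matrix A_e. -/

import Mathlib

open Filter Matrix

/-- The operator norm on `n × n` real matrices induced by the Euclidean norm on `ℝ^n`. -/
noncomputable def euclOpNorm {n : ℕ} (A : Matrix (Fin n) (Fin n) ℝ) : ℝ :=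
  ‖LinearMap.toContinuousLinearMap (Matrix.toEuclideanLin A)‖

/-- The Euclidean norm on `ℝ^n`. -/
noncomputable def euclNorm {n : ℕ} (x : Fin n → ℝ) : ℝ :=
  Real.sqrt (∑ i, x i ^ 2)

/-- The matrix product `A_{σ(t-1)} ⋯ A_{σ(0)}` associated to a sequence of labels `σ`. -/
noncomputable def pathProd {n N : ℕ} (A : Fin N → Matrix (Fin n) (Fin n) ℝ)
    (t : ℕ) (σ : Fin t → Fin N) : Matrix (Fin n) (Fin n) ℝ :=
  (List.ofFn fun i => A (σ i)).reverse.prod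

/-- `v, σ` describe a path of length `t` in the labeled graph with edge set `E`:
its `i`-th edge goes from node `v i` to node `v (i+1)` and carries the label `σ i`. -/
def IsPath {V : Type*} {N : ℕ} (E : Set (V × V × Fin N)) {t : ℕ}
    (v : Fin (t + 1) → V) (σ : Fin t → Fin N) : Prop :=
  ∀ i : Fin t, (v i.castSucc, v i.succ, σ i) ∈ E

/-- The labeled graph with edge set `E` is strongly connected: any node can be joined to
any node by a path of length at least 1. -/
def StronglyConnected {V : Type*} {N : ℕ} (E : Set (V × V × Fin N)) : Prop :=
  ∀ u w : V, ∃ (t : ℕ) (v : Fin (t + 1) → V) (σ : Fin t → Fin N),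
    1 ≤ t ∧ IsPath E v σ ∧ v 0 = u ∧ v (Fin.last t) = w

/-- The constrained joint spectral radius of the system `S(G, M)` with `G = (V, E)`, `M = A`. -/
noncomputable def cjsr {V : Type*} {n N : ℕ} (E : Set (V × V × Fin N))
    (A : Fin N → Matrix (Fin n) (Fin n) ℝ) : ℝ :=
  Filter.atTop.limsup fun t : ℕ =>
    sSup { x : ℝ | ∃ (v : Fin (t + 1) → V) (σ : Fin t → Fin N),
      IsPath E v σ ∧ x = euclOpNorm (pathProd A t σ) ^ (1 / (t : ℝ)) }

/-- The constrained joint spectral radius of the `T`-lifted system `S(G_T, M^T)`: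
paths of length `k` in `G_T` are exactly paths of length `k * T` in `G`. -/
noncomputable def cjsrLift {V : Type*} {n N : ℕ} (E : Set (V × V × Fin N))
    (A : Fin N → Matrix (Fin n) (Fin n) ℝ) (T : ℕ) : ℝ :=
  Filter.atTop.limsup fun k : ℕ =>
    sSup { x : ℝ | ∃ (v : Fin (k * T + 1) → V) (σ : Fin (k * T) → Fin N),
      IsPath E v σ ∧ x = euclOpNorm (pathProd A (k * T) σ) ^ (1 / (k : ℝ)) }

/-- Stability of the constrained switching system: along every infinite path of the graph,
every trajectory converges to `0`. -/
def Stable {V : Type*} {n N : ℕ} (E : Set (V × V × Fin N))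
    (A : Fin N → Matrix (Fin n) (Fin n) ℝ) : Prop :=
  ∀ (v : ℕ → V) (σ : ℕ → Fin N), (∀ t : ℕ, (v t, v (t + 1), σ t) ∈ E) →
    ∀ x0 : Fin n → ℝ,
      Tendsto (fun t : ℕ => (pathProd A t fun i : Fin t => σ i).mulVec x0)
        atTop (nhds 0)

/-- `ν` is a family of norms on `ℝ^n` indexed by the nodes. -/
def IsNormFamily {V : Type*} {n : ℕ} (ν : V → (Fin n → ℝ) → ℝ) : Prop :=
  ∀ u : V,
    (∀ x y : Fin n → ℝ, ν u (x + y) ≤ ν u x + ν u y) ∧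
    (∀ (a : ℝ) (x : Fin n → ℝ), ν u (a • x) = |a| * ν u x) ∧
    (∀ x : Fin n → ℝ, ν u x = 0 → x = 0)

/-- `ν` is a `γ`-multinorm for the system `S(G, M)`. -/
def IsMultinorm {V : Type*} {n N : ℕ} (E : Set (V × V × Fin N))
    (A : Fin N → Matrix (Fin n) (Fin n) ℝ) (γ : ℝ)
    (ν : V → (Fin n → ℝ) → ℝ) : Prop :=
  IsNormFamily ν ∧
    ∀ vi vj : V, ∀ σ : Fin N, (vi, vj, σ) ∈ E →
      ∀ x : Fin n → ℝ, ν vj ((A σ).mulVec x) ≤ γ * ν vi x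

/-- `Q` is a quadratic `γ`-multinorm for the system `S(G, M)`. -/
def IsQuadMultinorm {V : Type*} {n N : ℕ} (E : Set (V × V × Fin N))
    (A : Fin N → Matrix (Fin n) (Fin n) ℝ) (γ : ℝ)
    (Q : V → Matrix (Fin n) (Fin n) ℝ) : Prop :=
  (∀ u : V, (Q u).PosDef) ∧
    ∀ vi vj : V, ∀ σ : Fin N, (vi, vj, σ) ∈ E →
      (γ ^ 2 • Q vi - (A σ)ᵀ * Q vj * A σ).PosSemidef

/-- `Q` is a quadratic `γ`-multinorm for the lifted system `S(G_T, M^T)`: the Loewner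
inequality holds along every path of length `T` of `G` (i.e. every edge of `G_T`). -/
def IsQuadMultinormLift {V : Type*} {n N : ℕ} (E : Set (V × V × Fin N))
    (A : Fin N → Matrix (Fin n) (Fin n) ℝ) (T : ℕ) (γ : ℝ)
    (Q : V → Matrix (Fin n) (Fin n) ℝ) : Prop :=
  (∀ u : V, (Q u).PosDef) ∧
    ∀ (v : Fin (T + 1) → V) (σ : Fin T → Fin N), IsPath E v σ →
      (γ ^ 2 • Q (v 0) -
        (pathProd A T σ)ᵀ * Q (v (Fin.last T)) * pathProd A T σ).PosSemidef

/-- `Q` is a path-dependent Lyapunov function with memory `T` for `S(G, M)`: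
one positive definite quadratic form per path of length `T`, with a strict decrease
condition along every path of length `T + 1`. -/
def IsPathDepLyap {V : Type*} {n N : ℕ} (E : Set (V × V × Fin N))
    (A : Fin N → Matrix (Fin n) (Fin n) ℝ) (T : ℕ)
    (Q : (Fin (T + 1) → V) → (Fin T → Fin N) → Matrix (Fin n) (Fin n) ℝ) : Prop :=
  (∀ (v : Fin (T + 1) → V) (σ : Fin T → Fin N), IsPath E v σ → (Q v σ).PosDef) ∧
    ∀ (v : Fin (T + 2) → V) (σ : Fin (T + 1) → Fin N), IsPath E v σ →
      (Q (fun i : Fin (T + 1) => v i.castSucc) (fun i : Fin T => σ i.castSucc) -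
        (A (σ (Fin.last T)))ᵀ *
          Q (fun i : Fin (T + 1) => v i.succ) (fun i : Fin T => σ i.succ) *
            A (σ (Fin.last T))).PosDef

/-- The joint spectral radius of a finite set of matrices (arbitrary switching). -/
noncomputable def jsr {n N : ℕ} (A : Fin N → Matrix (Fin n) (Fin n) ℝ) : ℝ :=
  Filter.atTop.limsup fun t : ℕ =>
    sSup { x : ℝ | ∃ σ : Fin t → Fin N,
      x = euclOpNorm (pathProd A t σ) ^ (1 / (t : ℝ)) }

/-- The joint spectral radius of the set `M^T` of all products of `T` matrices from `M`:
products of `k` matrices from `M^T` are exactly products of `k * T` matrices from `M`. -/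
noncomputable def jsrPow {n N : ℕ} (A : Fin N → Matrix (Fin n) (Fin n) ℝ) (T : ℕ) : ℝ :=
  Filter.atTop.limsup fun k : ℕ =>
    sSup { x : ℝ | ∃ σ : Fin (k * T) → Fin N,
      x = euclOpNorm (pathProd A (k * T) σ) ^ (1 / (k : ℝ)) }

/-- The optimal value `γ*(G, M)` of the semidefinite program of Corollary 4.6. -/
noncomputable def gammaStar {V : Type*} {n N : ℕ} (E : Set (V × V × Fin N))
    (A : Fin N → Matrix (Fin n) (Fin n) ℝ) : ℝ :=
  sInf {γ : ℝ | 0 < γ ∧ ∃ Q : V → Matrix (Fin n) (Fin n) ℝ,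
    (∀ u : V, (Q u).PosDef) ∧ ∀ vi vj : V, ∀ σ : Fin N, (vi, vj, σ) ∈ E →
      (γ ^ 2 • Q vi - (A σ)ᵀ * Q vj * A σ).PosDef}

/-- The optimal value `γ*(G_T, M^T)` of the semidefinite program applied to the lifted
system `S(G_T, M^T)`. -/
noncomputable def gammaStarLift {V : Type*} {n N : ℕ} (E : Set (V × V × Fin N))
    (A : Fin N → Matrix (Fin n) (Fin n) ℝ) (T : ℕ) : ℝ :=
  sInf {γ : ℝ | 0 < γ ∧ ∃ Q : V → Matrix (Fin n) (Fin n) ℝ,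
    (∀ u : V, (Q u).PosDef) ∧
      ∀ (v : Fin (T + 1) → V) (σ : Fin T → Fin N), IsPath E v σ →
        (γ ^ 2 • Q (v 0) -
          (pathProd A T σ)ᵀ * Q (v (Fin.last T)) * pathProd A T σ).PosDef}

open scoped Matrix.Norms.L2Operator in
theorem euclOpNorm_eq_norm {n : ℕ} (A : Matrix (Fin n) (Fin n) ℝ) : euclOpNorm A = ‖A‖ := rfl

theorem pathProd_succ' {n N : ℕ} (A : Fin N → Matrix (Fin n) (Fin n) ℝ) (t : ℕ)
    (σ : Fin (t + 1) → Fin N) :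
    pathProd A (t + 1) σ = pathProd A t (fun i => σ i.succ) * A (σ 0) := by
  simp [pathProd, List.ofFn_succ]

open scoped MatrixOrder Matrix.Norms.L2Operator in
theorem psd_factor {n : ℕ} {P : Matrix (Fin n) (Fin n) ℝ} (hP : P.PosSemidef) :
    ∃ C : Matrix (Fin n) (Fin n) ℝ, P = Cᴴ * C :=
  CStarAlgebra.nonneg_iff_eq_star_mul_self.mp hP.nonneg

/-- A PSD matrix is dominated by its trace. -/
theorem posSemidef_trace_sub {n : ℕ} (P : Matrix (Fin n) (Fin n) ℝ) (hP : P.PosSemidef)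
    (c : ℝ) (hc : P.trace ≤ c) : (c • (1 : Matrix (Fin n) (Fin n) ℝ) - P).PosSemidef := by
  obtain ⟨C, rfl⟩ := psd_factor hP
  refine Matrix.PosSemidef.of_dotProduct_mulVec_nonneg ?_ ?_
  · exact ((Matrix.isHermitian_one).smul (by simp [IsSelfAdjoint])).sub hP.1
  · intro x
    have h1 : (star x) ⬝ᵥ ((c • (1 : Matrix (Fin n) (Fin n) ℝ) - Cᴴ * C) *ᵥ x)
        = c * ∑ j, x j ^ 2 - ∑ i, (∑ j, C i j * x j) ^ 2 := by
      rw [Matrix.sub_mulVec, dotProduct_sub, ← Matrix.mulVec_mulVec,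
        Matrix.dotProduct_mulVec _ Cᴴ, ← Matrix.star_mulVec, Matrix.smul_mulVec, Matrix.one_mulVec,
        dotProduct_smul]
      simp [dotProduct, Matrix.mulVec, pow_two]
    have h2 : (Cᴴ * C).trace = ∑ i, ∑ j, C i j ^ 2 := by
      rw [Finset.sum_comm]
      simp [Matrix.trace, Matrix.mul_apply, pow_two]
    rw [h1, sub_nonneg]
    calc ∑ i, (∑ j, C i j * x j) ^ 2 ≤ ∑ i, (∑ j, C i j ^ 2) * ∑ j, x j ^ 2 :=
          Finset.sum_le_sum fun i _ => Finset.sum_mul_sq_le_sq_mul_sq _ _ _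
      _ = (Cᴴ * C).trace * ∑ j, x j ^ 2 := by rw [h2, Finset.sum_mul]
      _ ≤ _ := mul_le_mul_of_nonneg_right hc (Finset.sum_nonneg fun j _ => sq_nonneg _)

/-- If `det` is maximal at `1` along a segment, then the trace of the direction is `≤ 0`. -/
theorem trace_nonpos_of_det_le {n : ℕ} (M : Matrix (Fin n) (Fin n) ℝ)
    (h : ∀ s : ℝ, 0 < s → s ≤ 1 → (1 + s • M).det ≤ 1) : M.trace ≤ 0 := by
  have hd := fun s : ℝ => Matrix.det_one_add_smul s M
  set p : ℝ → ℝ := fun s => Polynomial.eval s (Matrix.det (1 + (Polynomial.X : Polynomial ℝ) •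
    M.map Polynomial.C)).divX.divX with hp
  have hc : Continuous fun s : ℝ => M.trace + p s * s := by
    apply Continuous.add continuous_const
    exact (Polynomial.continuous _).mul continuous_id
  have ht : Tendsto (fun s : ℝ => M.trace + p s * s) (nhdsWithin 0 (Set.Ioi 0))
      (nhds M.trace) := by
    have := (hc.tendsto 0).mono_left (nhdsWithin_le_nhds (s := Set.Ioi (0:ℝ)))
    simpa using this
  refine le_of_tendsto ht ?_
  have : Set.Ioc (0:ℝ) 1 ∈ nhdsWithin (0:ℝ) (Set.Ioi 0) := Ioc_mem_nhdsGT one_pos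
  filter_upwards [this] with s hs
  have h1 := h s hs.1 hs.2
  rw [hd s] at h1
  have h2 : (M.trace + p s * s) * s ≤ 0 := by
    have : (M.trace + p s * s) * s = M.trace * s + p s * s ^ 2 := by ring
    rw [this]
    simp only [hp]
    linarith
  by_contra hcon
  push Not at hcon
  have := mul_pos hcon hs.1
  linarith

/-- Determinant maximisation (John / Kiefer-Wolfowitz). -/
theorem exists_dominating {n : ℕ} (C : Set (Matrix (Fin n) (Fin n) ℝ)) (hC : IsCompact C)
    (hconv : Convex ℝ C) (hpsd : ∀ M ∈ C, M.PosSemidef) (h1 : (1 : Matrix _ _ ℝ) ∈ C) :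
    ∃ Q ∈ C, Q.PosDef ∧ ∀ M ∈ C, ((n : ℝ) • Q - M).PosSemidef := by
  obtain ⟨Q, hQC, hQmax⟩ := hC.exists_isMaxOn ⟨1, h1⟩
    (f := fun M : Matrix (Fin n) (Fin n) ℝ => M.det) (continuous_id.matrix_det.continuousOn)
  have hdet : 0 < Q.det := by
    have := hQmax h1
    simp only [Set.mem_ofPred_eq, Matrix.det_one] at this
    linarith
  have hQu : IsUnit Q.det := isUnit_iff_ne_zero.mpr hdet.ne'
  have hQpd : Q.PosDef := (hpsd Q hQC).posDef_iff_isUnit.mpr ((Matrix.isUnit_iff_isUnit_det _).mpr hQu)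
  refine ⟨Q, hQC, hQpd, fun M hM => ?_⟩
  obtain ⟨B, hB⟩ := psd_factor (hpsd Q hQC)
  have hBu : IsUnit B.det := by
    rw [isUnit_iff_ne_zero]
    intro h0
    rw [hB, Matrix.det_mul, h0, mul_zero] at hdet
    exact lt_irrefl _ hdet
  have hBB : B * B⁻¹ = 1 := Matrix.mul_nonsing_inv _ hBu
  have hBB' : B⁻¹ * B = 1 := Matrix.nonsing_inv_mul _ hBu
  have hBH : B⁻¹ᴴ * Bᴴ = 1 := by rw [← Matrix.conjTranspose_mul, hBB, Matrix.conjTranspose_one]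
  have hBH' : Bᴴ * B⁻¹ᴴ = 1 := by rw [← Matrix.conjTranspose_mul, hBB', Matrix.conjTranspose_one]
  set P := B⁻¹ᴴ * M * B⁻¹ with hPdef
  have hMP : M = Bᴴ * P * B := by
    calc M = (Bᴴ * B⁻¹ᴴ) * M * (B⁻¹ * B) := by rw [hBH', hBB']; simp
      _ = _ := by simp only [hPdef, Matrix.mul_assoc]
  have hP : P.PosSemidef := (hpsd M hM).conjTranspose_mul_mul_same _
  have htr : (P - 1).trace ≤ 0 := by
    apply trace_nonpos_of_det_le
    intro s hs hs1
    have hmem : (1 - s) • Q + s • M ∈ C := hconv hQC hM (by linarith) hs.le (by ring)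
    have heq : (1 - s) • Q + s • M = Bᴴ * (1 + s • (P - 1)) * B := by
      rw [hMP, hB]
      simp only [Matrix.mul_add, Matrix.add_mul, Matrix.mul_sub, Matrix.sub_mul, smul_sub,
        sub_smul, Matrix.mul_smul, Matrix.smul_mul, Matrix.mul_one, one_smul]
      abel
    have hle := hQmax hmem
    simp only [Set.mem_ofPred_eq] at hle
    rw [heq, hB, Matrix.det_mul, Matrix.det_mul, Matrix.det_mul] at hle
    rw [hB, Matrix.det_mul] at hdet
    have : (Bᴴ.det * B.det) * (1 + s • (P - 1)).det ≤ (Bᴴ.det * B.det) * 1 := by linarith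
    exact le_of_mul_le_mul_left this hdet
  have htr' : P.trace ≤ n := by
    rw [Matrix.trace_sub, Matrix.trace_one] at htr
    simp at htr
    exact htr
  have := (posSemidef_trace_sub P hP n htr').conjTranspose_mul_mul_same B
  convert this using 1
  rw [hMP, hB]
  simp only [Matrix.mul_sub, Matrix.sub_mul, Matrix.mul_smul, Matrix.smul_mul, Matrix.mul_one]

open scoped Matrix.Norms.L2Operator in
theorem norm_pathProd_le {n N : ℕ} (A : Fin N → Matrix (Fin n) (Fin n) ℝ) (K : ℝ) (hK : 1 ≤ K)
    (hA : ∀ i, ‖A i‖ ≤ K) (t : ℕ) (σ : Fin t → Fin N) : ‖pathProd A t σ‖ ≤ K ^ t := by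
  induction t with
  | zero =>
    have : pathProd A 0 σ = 1 := by simp [pathProd]
    rw [this, pow_zero, Matrix.l2_opNorm_def]
    simp only [LinearEquiv.trans_apply, Matrix.toLpLin_one]
    exact ContinuousLinearMap.norm_id_le
  | succ t ih =>
    rw [pathProd_succ', pow_succ]
    exact (Matrix.l2_opNorm_mul _ _).trans
      (mul_le_mul (ih _) (hA _) (norm_nonneg _) (by positivity))

/-- Normalised Gram matrices of paths issued from `i`. -/
def gramSet {V : Type} {n N : ℕ} (E : Set (V × V × Fin N))
    (A : Fin N → Matrix (Fin n) (Fin n) ℝ) (r : ℝ) (i : V) : Set (Matrix (Fin n) (Fin n) ℝ) :=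
  {M | ∃ (t : ℕ) (v : Fin (t + 1) → V) (σ : Fin t → Fin N), IsPath E v σ ∧ v 0 = i ∧
    M = ((r ^ 2)⁻¹ ^ t) • ((pathProd A t σ)ᵀ * pathProd A t σ)}

theorem gramSet_edge {V : Type} {n N : ℕ} (E : Set (V × V × Fin N))
    (A : Fin N → Matrix (Fin n) (Fin n) ℝ) (r : ℝ) (i j : V) (a : Fin N) (he : (i, j, a) ∈ E)
    (M : Matrix (Fin n) (Fin n) ℝ) (hM : M ∈ gramSet E A r j) :
    (r ^ 2)⁻¹ • ((A a)ᵀ * M * A a) ∈ gramSet E A r i := by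
  obtain ⟨t, v, σ, hp, h0, rfl⟩ := hM
  refine ⟨t + 1, Fin.cons i v, Fin.cons a σ, ?_, rfl, ?_⟩
  · intro k
    refine Fin.cases ?_ (fun k => ?_) k
    · simpa [h0] using he
    · simpa [← Fin.succ_castSucc] using hp k
  · rw [pathProd_succ']
    simp only [Fin.cons_succ, Fin.cons_zero, Matrix.transpose_mul, Matrix.mul_smul,
      Matrix.smul_mul, smul_smul, pow_succ', Matrix.mul_assoc]

theorem hull_edge {V : Type} {n N : ℕ} (E : Set (V × V × Fin N))
    (A : Fin N → Matrix (Fin n) (Fin n) ℝ) (r : ℝ) (i j : V) (a : Fin N) (he : (i, j, a) ∈ E)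
    (M : Matrix (Fin n) (Fin n) ℝ) (hM : M ∈ closure (convexHull ℝ (gramSet E A r j))) :
    (r ^ 2)⁻¹ • ((A a)ᵀ * M * A a) ∈ closure (convexHull ℝ (gramSet E A r i)) := by
  let f : Matrix (Fin n) (Fin n) ℝ →ₗ[ℝ] Matrix (Fin n) (Fin n) ℝ :=
    { toFun := fun M => (r ^ 2)⁻¹ • ((A a)ᵀ * M * A a)
      map_add' := by intro x y; simp [Matrix.mul_add, Matrix.add_mul]
      map_smul' := by intro c x; simp [smul_smul, mul_comm] }
  have hf : Continuous f := by
    show Continuous fun M : Matrix (Fin n) (Fin n) ℝ => (r ^ 2)⁻¹ • ((A a)ᵀ * M * A a)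
    fun_prop
  have hsub : convexHull ℝ (gramSet E A r j) ⊆ f ⁻¹' (convexHull ℝ (gramSet E A r i)) := by
    apply convexHull_min
    · intro M hM
      exact subset_convexHull ℝ _ (gramSet_edge E A r i j a he M hM)
    · exact (convex_convexHull ℝ _).linear_preimage f
  exact (Set.MapsTo.closure (t := convexHull ℝ (gramSet E A r i)) hsub hf) hM

theorem hull_path {V : Type} {n N : ℕ} (E : Set (V × V × Fin N))
    (A : Fin N → Matrix (Fin n) (Fin n) ℝ) (r : ℝ) (t : ℕ) (v : Fin (t + 1) → V)
    (σ : Fin t → Fin N) (hp : IsPath E v σ)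
    (M : Matrix (Fin n) (Fin n) ℝ)
    (hM : M ∈ closure (convexHull ℝ (gramSet E A r (v (Fin.last t))))) :
    ((r ^ 2)⁻¹ ^ t) • ((pathProd A t σ)ᵀ * M * pathProd A t σ) ∈
      closure (convexHull ℝ (gramSet E A r (v 0))) := by
  induction t with
  | zero => simpa [pathProd] using hM
  | succ t ih =>
    have h1 := ih (fun i => v i.succ) (fun i => σ i.succ) (fun i => by
      have := hp i.succ
      rwa [← Fin.succ_castSucc] at this) (by simpa using hM)
    have h2 := hull_edge E A r (v 0) (v 1) (σ 0) (hp 0) _ h1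
    convert h2 using 1
    rw [pathProd_succ']
    simp only [Matrix.transpose_mul, Matrix.mul_smul,
      Matrix.smul_mul, smul_smul, pow_succ', Matrix.mul_assoc]

theorem hull_psd {V : Type} {n N : ℕ} (E : Set (V × V × Fin N))
    (A : Fin N → Matrix (Fin n) (Fin n) ℝ) (r : ℝ) (i : V)
    (M : Matrix (Fin n) (Fin n) ℝ) (hM : M ∈ closure (convexHull ℝ (gramSet E A r i))) :
    M.PosSemidef := by
  have hcl : IsClosed {M : Matrix (Fin n) (Fin n) ℝ | M.PosSemidef} := by
    have : {M : Matrix (Fin n) (Fin n) ℝ | M.PosSemidef} =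
        {M | Mᴴ = M} ∩ ⋂ x : Fin n → ℝ, {M | 0 ≤ star x ⬝ᵥ (M *ᵥ x)} := by
      ext M
      simp only [Set.mem_ofPred_eq, Set.mem_inter_iff, Set.mem_iInter,
        Matrix.posSemidef_iff_dotProduct_mulVec]
      rfl
    rw [this]
    refine (isClosed_eq (by fun_prop) continuous_id).inter (isClosed_iInter fun x => ?_)
    exact isClosed_le continuous_const (by fun_prop)
  refine closure_minimal (convexHull_min ?_ ?_) hcl hM
  · rintro _ ⟨t, v, σ, -, -, rfl⟩
    have := (Matrix.posSemidef_conjTranspose_mul_self (pathProd A t σ)).smul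
      (show (0:ℝ) ≤ (r ^ 2)⁻¹ ^ t by positivity)
    simpa [Matrix.conjTranspose_eq_transpose_of_trivial] using this
  · intro X hX Y hY a b ha hb _
    exact (Matrix.PosSemidef.smul hX ha).add (Matrix.PosSemidef.smul hY hb)

open scoped Matrix.Norms.L2Operator in
theorem hull_compact {V : Type} {n N : ℕ} (E : Set (V × V × Fin N))
    (A : Fin N → Matrix (Fin n) (Fin n) ℝ) (r : ℝ) (hr : 0 < r) (hr1 : r ≤ 1) (K : ℝ)
    (hK : 1 ≤ K) (hA : ∀ i, ‖A i‖ ≤ K) (t0 : ℕ)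
    (ht0 : ∀ t, t0 ≤ t → ∀ (v : Fin (t + 1) → V) (σ : Fin t → Fin N), IsPath E v σ →
      ‖pathProd A t σ‖ ≤ r ^ t) (i : V) :
    IsCompact (closure (convexHull ℝ (gramSet E A r i))) := by
  have : ProperSpace (Matrix (Fin n) (Fin n) ℝ) := FiniteDimensional.proper ℝ _
  refine Bornology.IsBounded.isCompact_closure ?_
  rw [isBounded_convexHull]
  refine (Metric.isBounded_closedBall (x := 0) (r := ((K / r) ^ 2) ^ t0)).subset ?_
  rintro _ ⟨t, v, σ, hp, -, rfl⟩
  have hKr : 1 ≤ K / r := by rw [le_div_iff₀ hr]; linarith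
  have hn : ‖(pathProd A t σ)ᵀ * pathProd A t σ‖ = ‖pathProd A t σ‖ ^ 2 := by
    rw [← Matrix.conjTranspose_eq_transpose_of_trivial, Matrix.l2_opNorm_conjTranspose_mul_self,
      pow_two]
  rw [mem_closedBall_zero_iff, norm_smul, hn, Real.norm_of_nonneg (by positivity)]
  rcases le_total t0 t with h | h
  · have h1 := ht0 t h v σ hp
    calc (r ^ 2)⁻¹ ^ t * ‖pathProd A t σ‖ ^ 2 ≤ (r ^ 2)⁻¹ ^ t * (r ^ t) ^ 2 := by gcongr
      _ = 1 := by rw [inv_pow, ← pow_mul, ← pow_mul, mul_comm t 2]; field_simp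
      _ ≤ _ := one_le_pow₀ (one_le_pow₀ hKr)
  · have h1 := norm_pathProd_le A K hK hA t σ
    calc (r ^ 2)⁻¹ ^ t * ‖pathProd A t σ‖ ^ 2 ≤ (r ^ 2)⁻¹ ^ t * (K ^ t) ^ 2 := by gcongr
      _ = ((K / r) ^ 2) ^ t := by
        rw [div_pow, div_pow, inv_pow, ← pow_mul K, mul_comm t 2, pow_mul]; field_simp
      _ ≤ _ := pow_le_pow_right₀ (one_le_pow₀ hKr) h

open scoped Matrix.Norms.L2Operator in
theorem eventually_norm_le {V : Type} {n N : ℕ} (E : Set (V × V × Fin N))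
    (A : Fin N → Matrix (Fin n) (Fin n) ℝ) (r : ℝ) (hr : 0 < r) (hρ : cjsr E A < r) (K : ℝ)
    (hK : 1 ≤ K) (hA : ∀ i, ‖A i‖ ≤ K) :
    ∃ t0 : ℕ, ∀ t, t0 ≤ t → ∀ (v : Fin (t + 1) → V) (σ : Fin t → Fin N), IsPath E v σ →
      ‖pathProd A t σ‖ ≤ r ^ t := by
  have hb : ∀ (t : ℕ) (σ : Fin t → Fin N), ‖pathProd A t σ‖ ^ (1 / (t : ℝ)) ≤ K := by
    intro t σ
    rcases Nat.eq_zero_or_pos t with rfl | ht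
    · simpa using hK
    · calc ‖pathProd A t σ‖ ^ (1 / (t : ℝ)) ≤ (K ^ t) ^ (1 / (t : ℝ)) :=
            Real.rpow_le_rpow (norm_nonneg _) (norm_pathProd_le A K hK hA t σ) (by positivity)
        _ = K := by
            rw [one_div]
            exact Real.pow_rpow_inv_natCast (by linarith) ht.ne'
  unfold cjsr at hρ
  have hev := eventually_lt_of_limsup_lt hρ (Filter.isBoundedUnder_of_eventually_le (a := K) (by
    refine Eventually.of_forall fun t => Real.sSup_le ?_ (by linarith)
    rintro _ ⟨v, σ, -, rfl⟩
    exact hb t σ))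
  obtain ⟨t0, ht0⟩ := eventually_atTop.mp hev
  refine ⟨t0 + 1, fun t ht v σ hp => ?_⟩
  have h1 := ht0 t (by omega)
  have h2 : ‖pathProd A t σ‖ ^ (1 / (t : ℝ)) ≤ r := by
    refine le_of_lt (lt_of_le_of_lt (le_csSup ?_ ?_) h1)
    swap
    · exact ⟨v, σ, hp, rfl⟩
    refine ⟨K, ?_⟩
    rintro _ ⟨v, σ, -, rfl⟩
    exact hb t σ
  calc ‖pathProd A t σ‖ = (‖pathProd A t σ‖ ^ (1 / (t : ℝ))) ^ t := by
        rw [one_div, Real.rpow_inv_natCast_pow (norm_nonneg _) (by omega)]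
    _ ≤ r ^ t := by gcongr

/-- if `ρ̂(G, M) < 1 - ε` and `T ≥ -log n / log((1-ε)²)`, then `S(G_T, M^T)`
admits a quadratic Lyapunov multinorm. -/
theorem exists_quad_lyapunov_multinorm_lift_of_stable {n N : ℕ} (hn : 1 ≤ n) (hN : 1 ≤ N)
    {V : Type} [Fintype V] [Nonempty V]
    (E : Set (V × V × Fin N)) (A : Fin N → Matrix (Fin n) (Fin n) ℝ)
    (hconn : StronglyConnected E)
    (ε : ℝ) (hε0 : 0 < ε) (hε1 : ε < 1)
    (hρ : cjsr E A < 1 - ε)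
    (T : ℕ) (hT : 1 ≤ T)
    (hTbig : -Real.log n / Real.log ((1 - ε) ^ 2) ≤ (T : ℝ)) :
    ∃ γ : ℝ, 0 < γ ∧ γ < 1 ∧
      ∃ Q : V → Matrix (Fin n) (Fin n) ℝ, IsQuadMultinormLift E A T γ Q := by
  obtain ⟨K, hK, hA⟩ : ∃ K : ℝ, 1 ≤ K ∧ ∀ i, euclOpNorm (A i) ≤ K := by
    refine ⟨1 + ∑ i, euclOpNorm (A i), ?_, fun i => ?_⟩
    · have : 0 ≤ ∑ i, euclOpNorm (A i) := Finset.sum_nonneg fun i _ => norm_nonneg _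
      linarith
    · have := Finset.single_le_sum (f := fun i => euclOpNorm (A i))
        (fun i _ => norm_nonneg _) (Finset.mem_univ i)
      linarith
  obtain ⟨r, hr1, hr2⟩ := exists_between (max_lt hρ (sub_pos.mpr hε1))
  obtain ⟨hρr, hr⟩ := max_lt_iff.mp hr1
  obtain ⟨t0, ht0⟩ := eventually_norm_le E A r hr hρr K hK hA
  have key : ∀ i : V, ∃ Q ∈ closure (convexHull ℝ (gramSet E A r i)), Q.PosDef ∧
      ∀ M ∈ closure (convexHull ℝ (gramSet E A r i)), ((n : ℝ) • Q - M).PosSemidef := by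
    intro i
    refine exists_dominating _ (hull_compact E A r hr (by linarith) K hK hA t0 ht0 i)
      (convex_convexHull ℝ _).closure (hull_psd E A r i) ?_
    refine subset_closure (subset_convexHull ℝ _ ⟨0, fun _ => i, Fin.elim0, ?_, rfl, ?_⟩)
    · intro k; exact k.elim0
    · simp [pathProd]
  choose Q hQmem hQpd hQdom using key
  have hnpos : (0 : ℝ) < n := by exact_mod_cast hn
  have hbound : (n : ℝ) * (r ^ T) ^ 2 < 1 := by
    have h1 : Real.log ((1 - ε) ^ 2) < 0 := by
      apply Real.log_neg <;> nlinarith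
    rw [div_le_iff_of_neg h1] at hTbig
    have hpos : 0 < ((1 - ε) ^ 2) ^ T := by
      have : 0 < 1 - ε := by linarith
      positivity
    have h2 : Real.log (n * ((1 - ε) ^ 2) ^ T) ≤ 0 := by
      rw [Real.log_mul hnpos.ne' hpos.ne', Real.log_pow]
      linarith
    have h3 : (n : ℝ) * ((1 - ε) ^ 2) ^ T ≤ 1 :=
      (Real.log_nonpos_iff (by positivity)).mp h2
    refine lt_of_lt_of_le ?_ h3
    rw [← pow_mul, mul_comm T 2, pow_mul]
    refine mul_lt_mul_of_pos_left ?_ hnpos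
    exact pow_lt_pow_left₀ (pow_lt_pow_left₀ hr2 hr.le two_ne_zero) (by positivity) (by omega)
  have hγ2 : (Real.sqrt n * r ^ T) ^ 2 = n * (r ^ T) ^ 2 := by
    rw [mul_pow, Real.sq_sqrt hnpos.le]
  have hγpos : 0 < Real.sqrt n * r ^ T := mul_pos (Real.sqrt_pos.mpr hnpos) (by positivity)
  refine ⟨Real.sqrt n * r ^ T, hγpos, ?_, Q, hQpd, ?_⟩
  · rw [← hγ2] at hbound
    nlinarith
  · intro v σ hp
    have h1 := hQdom (v 0) _ (hull_path E A r T v σ hp _ (hQmem (v (Fin.last T))))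
    have h2 := h1.smul (show (0 : ℝ) ≤ (r ^ 2) ^ T by positivity)
    convert h2 using 1
    rw [hγ2, smul_sub, smul_smul, smul_smul, inv_pow, mul_inv_cancel₀ (by positivity), one_smul,
      mul_comm, ← pow_mul, ← pow_mul, mul_comm T 2]
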